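/- Fix k > 0 and let f, g ∈ V₃. With ℓ[f](x) := -(1-x²)f''(x) + k·f(x) and φ(u,v) := ½u(-1)v̄(-1) + ½u(1)v̄(1) + ∫_{-1}^{1} u'v̄' dx, one has φ(ℓ[f], g) = ∫_{-1}^{1} [(1-x²)f''(x)ḡ''(x) + k·f'(x)ḡ'(x)] dx = φ(f, ℓ[g]). In particular, the operator T₁f := ℓ[f] with domain V₃ is symmetric in the Hilbert space (W₁, φ(·,·)). -/

import Mathlib

open MeasureTheory Set Filter Topology

/-- Membership in the third left-definite space `V₃`, encoded via the derivative
functions `f', f'', f'''`. -/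
def InV3 (f f' f'' f''' : ℝ → ℂ) : Prop :=
  (∀ x ∈ Ioo (-1 : ℝ) 1, ∀ y ∈ Ioo (-1 : ℝ) 1, IntervalIntegrable f' volume x y) ∧
  (∀ x ∈ Ioo (-1 : ℝ) 1, ∀ y ∈ Ioo (-1 : ℝ) 1, IntervalIntegrable f'' volume x y) ∧
  (∀ x ∈ Ioo (-1 : ℝ) 1, ∀ y ∈ Ioo (-1 : ℝ) 1, IntervalIntegrable f''' volume x y) ∧
  (∀ x ∈ Ioo (-1 : ℝ) 1, ∀ y ∈ Ioo (-1 : ℝ) 1, f y - f x = ∫ t in x..y, f' t) ∧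
  (∀ x ∈ Ioo (-1 : ℝ) 1, ∀ y ∈ Ioo (-1 : ℝ) 1, f' y - f' x = ∫ t in x..y, f'' t) ∧
  (∀ x ∈ Ioo (-1 : ℝ) 1, ∀ y ∈ Ioo (-1 : ℝ) 1, f'' y - f'' x = ∫ t in x..y, f''' t) ∧
  IntegrableOn (fun x => (1 - x ^ 2) ^ 2 * ‖f''' x‖ ^ 2) (Ioo (-1 : ℝ) 1) ∧
  IntegrableOn (fun x => (1 - x ^ 2) * ‖f'' x‖ ^ 2) (Ioo (-1 : ℝ) 1) ∧
  IntegrableOn (fun x => ‖f' x‖ ^ 2) (Ioo (-1 : ℝ) 1) ∧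
  IntegrableOn (fun x => ‖f x‖ ^ 2 * (1 - x ^ 2)⁻¹) (Ioo (-1 : ℝ) 1)


lemma v3_ac_primitive {h : ℝ → ℂ} {a b : ℝ} (hh : IntervalIntegrable h volume a b) :
    AbsolutelyContinuousOnInterval (fun x => ∫ t in a..x, h t) a b := by
  have hc : ∀ z : ℂ, AbsolutelyContinuousOnInterval (fun _ : ℝ => z) a b := fun z =>
    LipschitzOnWith.absolutelyContinuousOnInterval (K := 0) (LipschitzWith.const z).lipschitzOnWith
  have hre : IntervalIntegrable (fun t => (h t).re) volume a b :=
    ⟨hh.1.re, hh.2.re⟩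
  have him : IntervalIntegrable (fun t => (h t).im) volume a b :=
    ⟨hh.1.im, hh.2.im⟩
  have h1 := (hre.absolutelyContinuousOnInterval_intervalIntegral (c := a) (by simp)).fun_smul (hc 1)
  have h2 := (him.absolutelyContinuousOnInterval_intervalIntegral (c := a) (by simp)).fun_smul
    (hc Complex.I)
  have h3 := h1.fun_add h2
  unfold AbsolutelyContinuousOnInterval at h3 ⊢
  refine h3.congr' ?_
  rw [EventuallyEq, eventually_inf_principal]
  refine Eventually.of_forall fun E hE => ?_
  have key : ∀ x ∈ uIcc a b, (∫ t in a..x, (h t).re) • (1 : ℂ) + (∫ t in a..x, (h t).im) • Complex.I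
      = ∫ t in a..x, h t := by
    intro x hx
    have hx' : IntervalIntegrable h volume a x := hh.mono_set (uIcc_subset_uIcc left_mem_uIcc hx)
    have e1 : ∫ t in a..x, (h t).re = (∫ t in a..x, h t).re :=
      Complex.reCLM.intervalIntegral_comp_comm hx'
    have e2 : ∫ t in a..x, (h t).im = (∫ t in a..x, h t).im :=
      Complex.imCLM.intervalIntegral_comp_comm hx'
    rw [e1, e2]
    simp
  refine Finset.sum_congr rfl fun i hi => ?_
  have hm := hE.1 i hi
  simp only [key _ hm.1, key _ hm.2]

/-- Integration by parts for primitives of integrable functions. -/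
lemma v3_parts {a b : ℝ} {u u' v v' : ℝ → ℂ}
    (hu' : IntervalIntegrable u' volume a b) (hv' : IntervalIntegrable v' volume a b)
    (hu : ∀ x ∈ uIcc a b, u x - u a = ∫ t in a..x, u' t)
    (hv : ∀ x ∈ uIcc a b, v x - v a = ∫ t in a..x, v' t) :
    IntervalIntegrable (fun t => u' t * v t + u t * v' t) volume a b ∧
    u b * v b - u a * v a = ∫ t in a..b, (u' t * v t + u t * v' t) := by
  have hc : ∀ z : ℂ, AbsolutelyContinuousOnInterval (fun _ : ℝ => z) a b := fun z =>
    LipschitzOnWith.absolutelyContinuousOnInterval (K := 0) (LipschitzWith.const z).lipschitzOnWith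
  set U : ℝ → ℂ := fun x => u a + ∫ t in a..x, u' t with hU
  set V : ℝ → ℂ := fun x => v a + ∫ t in a..x, v' t with hV
  have hUu : ∀ x ∈ uIcc a b, u x = U x := fun x hx => by simp only [hU, ← hu x hx]; ring
  have hVv : ∀ x ∈ uIcc a b, v x = V x := fun x hx => by simp only [hV, ← hv x hx]; ring
  have acU : AbsolutelyContinuousOnInterval U a b := (hc _).fun_add (v3_ac_primitive hu')
  have acV : AbsolutelyContinuousOnInterval V a b := (hc _).fun_add (v3_ac_primitive hv')
  have hi : IntervalIntegrable (fun t => u' t * V t + U t * v' t) volume a b :=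
    (hu'.mul_continuousOn acV.continuousOn).add (hv'.continuousOn_mul acU.continuousOn)
  have hcongr : EqOn (fun t => u' t * V t + U t * v' t) (fun t => u' t * v t + u t * v' t)
      (uIcc a b) := fun x hx => by simp only [hUu x hx, hVv x hx]
  have hi2 : IntervalIntegrable (fun t => u' t * v t + u t * v' t) volume a b :=
    hi.congr (fun x hx => hcongr (uIoc_subset_uIcc hx))
  refine ⟨hi2, ?_⟩
  have acG : AbsolutelyContinuousOnInterval
      (fun x => U x • V x - ∫ t in a..x, (u' t * V t + U t * v' t)) a b :=
    (acU.fun_smul acV).fun_sub (v3_ac_primitive hi)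
  obtain ⟨C, hC⟩ := acG.const_of_ae_hasDerivAt_zero (by
    filter_upwards [hu'.ae_hasDerivAt_integral, hv'.ae_hasDerivAt_integral,
      hi.ae_hasDerivAt_integral] with x h1 h2 h3 hx
    have d1 := (h1 hx a left_mem_uIcc).const_add (u a)
    have d2 := (h2 hx a left_mem_uIcc).const_add (v a)
    have d3 := (d1.mul d2).sub (h3 hx a left_mem_uIcc)
    have e0 : u' x * (v a + ∫ t in a..x, v' t) + (u a + ∫ t in a..x, u' t) * v' x
        - (u' x * V x + U x * v' x) = 0 := sub_self _
    rw [e0] at d3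
    exact d3)
  have ha := hC a left_mem_uIcc
  have hb := hC b right_mem_uIcc
  rw [← intervalIntegral.integral_congr hcongr, hUu a left_mem_uIcc, hVv a left_mem_uIcc,
    hUu b right_mem_uIcc, hVv b right_mem_uIcc]
  simp only [smul_eq_mul, intervalIntegral.integral_same, sub_zero] at ha hb
  rw [ha, ← hb]; ring

lemma v3_meas {h : ℝ → ℂ}
    (hh : ∀ x ∈ Ioo (-1 : ℝ) 1, ∀ y ∈ Ioo (-1 : ℝ) 1, IntervalIntegrable h volume x y) :
    AEStronglyMeasurable h (volume.restrict (Ioo (-1 : ℝ) 1)) := by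
  apply LocallyIntegrableOn.aestronglyMeasurable
  intro x hx
  obtain ⟨a, ha1, ha2⟩ := exists_between hx.1
  obtain ⟨b, hb1, hb2⟩ := exists_between hx.2
  refine ⟨Ioc a b, mem_nhdsWithin_of_mem_nhds (Ioc_mem_nhds ha2 hb1), ?_⟩
  exact (hh a ⟨ha1, by linarith⟩ b ⟨by linarith, hb2⟩).1

lemma v3_L2 {h : ℝ → ℂ} (hm : AEStronglyMeasurable h (volume.restrict (Ioo (-1 : ℝ) 1)))
    (hi : IntegrableOn (fun x => ‖h x‖ ^ 2) (Ioo (-1 : ℝ) 1)) :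
    IntegrableOn h (Ioo (-1 : ℝ) 1) := by
  have h1 : IntegrableOn (fun _ : ℝ => (1 : ℝ)) (Ioo (-1 : ℝ) 1) := by simp
  refine Integrable.mono' (h1.add hi) hm (Eventually.of_forall fun x => ?_)
  simp only [Pi.add_apply]
  nlinarith [sq_nonneg (‖h x‖ - 1), sq_nonneg (‖h x‖)]

lemma v3_uIoc {x : ℝ} (hx : x ∈ Ioo (-1 : ℝ) 1) : uIcc 0 x ⊆ Ioo (-1 : ℝ) 1 := by
  intro t ht
  rw [mem_uIcc] at ht
  constructor <;> rcases ht with h | h <;> linarith [hx.1, hx.2, h.1, h.2]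

/-- primitive of integrable is bounded -/
lemma v3_bdd {h h' : ℝ → ℂ} (hi : IntegrableOn h' (Ioo (-1 : ℝ) 1))
    (hh : ∀ x ∈ Ioo (-1 : ℝ) 1, ∀ y ∈ Ioo (-1 : ℝ) 1, h y - h x = ∫ t in x..y, h' t) :
    ∃ K, ∀ x ∈ Ioo (-1 : ℝ) 1, ‖h x‖ ≤ K := by
  refine ⟨‖h 0‖ + ∫ t in Ioo (-1 : ℝ) 1, ‖h' t‖, fun x hx => ?_⟩
  have h0 := hh 0 (by norm_num) x hx
  have h1 : ‖∫ t in (0:ℝ)..x, h' t‖ ≤ ∫ t in Ioo (-1 : ℝ) 1, ‖h' t‖ :=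
    intervalIntegral.norm_integral_le_integral_norm_uIoc.trans
      (setIntegral_mono_set hi.norm (Eventually.of_forall fun _ => norm_nonneg _)
        (uIoc_subset_uIcc.trans (v3_uIoc hx)).eventuallyLE)
  calc ‖h x‖ = ‖h 0 + (h x - h 0)‖ := by congr 1; ring
    _ ≤ ‖h 0‖ + ‖h x - h 0‖ := norm_add_le _ _
    _ ≤ _ := by rw [h0]; gcongr

lemma v3_sqrt_bound {h h' : ℝ → ℂ}
    (hh : ∀ x ∈ Ioo (-1 : ℝ) 1, ∀ y ∈ Ioo (-1 : ℝ) 1, h y - h x = ∫ t in x..y, h' t)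
    (hi : IntegrableOn (fun x => (1 - x ^ 2) ^ 2 * ‖h' x‖ ^ 2) (Ioo (-1 : ℝ) 1)) :
    ∃ M, 0 ≤ M ∧ ∀ x ∈ Ioo (-1 : ℝ) 1, ‖h x‖ * √(1 - x ^ 2) ≤ M := by
  set N := ∫ t in Ioo (-1 : ℝ) 1, (1 - t ^ 2) ^ 2 * ‖h' t‖ ^ 2 with hN
  have hN0 : 0 ≤ N := integral_nonneg fun t => by positivity
  refine ⟨‖h 0‖ + N / 2 + 1 / 2, by positivity, fun x hx => ?_⟩
  have hs : 0 < 1 - x ^ 2 := by nlinarith [hx.1, hx.2]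
  set r := √(1 - x ^ 2) with hr
  have hr0 : 0 < r := Real.sqrt_pos.2 hs
  have hr2 : r ^ 2 = 1 - x ^ 2 := Real.sq_sqrt hs.le
  have hr1 : r ≤ 1 := by nlinarith [sq_nonneg x]
  have h0 := hh 0 (by norm_num) x hx
  have hw : ∀ t ∈ uIcc 0 x, 0 < 1 - t ^ 2 := fun t ht => by
    have := v3_uIoc hx ht
    nlinarith [this.1, this.2]
  have hi1 : IntervalIntegrable (fun t => (1 - t ^ 2) ^ 2 * ‖h' t‖ ^ 2) volume 0 x := by
    rw [intervalIntegrable_iff]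
    exact hi.mono_set (uIoc_subset_uIcc.trans (v3_uIoc hx))
  have hi2 : IntervalIntegrable (fun t : ℝ => (1 + t ^ 2) / (1 - t ^ 2) ^ 2) volume 0 x := by
    apply ContinuousOn.intervalIntegrable
    apply ContinuousOn.div (by fun_prop) (by fun_prop)
    intro t ht
    have := hw t ht
    positivity
  have hJ : ∫ t in (0:ℝ)..x, (1 + t ^ 2) / (1 - t ^ 2) ^ 2 = x / (1 - x ^ 2) := by
    rw [intervalIntegral.integral_eq_sub_of_hasDerivAt (f := fun t => t / (1 - t ^ 2)) _ hi2]
    · simp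
    · intro t ht
      have h1 := (hasDerivAt_id t).div (((hasDerivAt_id t).pow 2).const_sub 1) (hw t ht).ne'
      refine h1.congr_deriv ?_
      simp only [Nat.cast_ofNat, id]
      congr 1
      norm_num
      ring
  have hI : |∫ t in (0:ℝ)..x, (1 - t ^ 2) ^ 2 * ‖h' t‖ ^ 2| ≤ N := by
    have := (intervalIntegral.norm_integral_le_integral_norm_uIoc (μ := volume) (a := 0) (b := x)
      (f := fun t => (1 - t ^ 2) ^ 2 * ‖h' t‖ ^ 2)).trans
      (setIntegral_mono_set hi.norm (Eventually.of_forall fun _ => norm_nonneg _)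
        (uIoc_subset_uIcc.trans (v3_uIoc hx)).eventuallyLE)
    rw [Real.norm_eq_abs] at this
    refine this.trans_eq ?_
    refine integral_congr_ae (Eventually.of_forall fun t => ?_)
    simp only [Real.norm_eq_abs]
    exact abs_of_nonneg (by positivity)
  have hb : ‖∫ t in (0:ℝ)..x, h' t‖ ≤ |∫ t in (0:ℝ)..x,
      ((2 * r)⁻¹ * ((1 - t ^ 2) ^ 2 * ‖h' t‖ ^ 2) + r / 2 * ((1 + t ^ 2) / (1 - t ^ 2) ^ 2))| := by
    apply intervalIntegral.norm_integral_le_abs_of_norm_le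
    · rw [ae_restrict_iff' measurableSet_uIoc]
      refine Eventually.of_forall fun t ht => ?_
      have hwt := hw t (uIoc_subset_uIcc ht)
      set w := 1 - t ^ 2
      have e1 : 1 / w ^ 2 ≤ (1 + t ^ 2) / w ^ 2 := by gcongr; nlinarith [sq_nonneg t]
      have e2 : ‖h' t‖ ≤ (2 * r)⁻¹ * (w ^ 2 * ‖h' t‖ ^ 2) + r / 2 * (1 / w ^ 2) := by
        have : (2 * r)⁻¹ * (w ^ 2 * ‖h' t‖ ^ 2) + r / 2 * (1 / w ^ 2) - ‖h' t‖
          = (w ^ 2 * ‖h' t‖ - r) ^ 2 / (2 * r * w ^ 2) := by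
          field_simp; ring
        have h2 : 0 ≤ (w ^ 2 * ‖h' t‖ - r) ^ 2 / (2 * r * w ^ 2) := by positivity
        linarith
      refine e2.trans ?_
      gcongr
    · exact (hi1.const_mul _).add (hi2.const_mul _)
  rw [intervalIntegral.integral_add (hi1.const_mul _) (hi2.const_mul _),
    intervalIntegral.integral_const_mul, intervalIntegral.integral_const_mul, hJ] at hb
  have hb2 : ‖∫ t in (0:ℝ)..x, h' t‖ ≤ (2 * r)⁻¹ * N + r / 2 * (1 / r ^ 2) := by
    refine hb.trans ((abs_add_le _ _).trans ?_)
    rw [abs_mul, abs_mul, abs_of_pos (show 0 < r / 2 by positivity),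
      abs_of_pos (show 0 < (2 * r)⁻¹ by positivity), abs_div, ← hr2, abs_of_pos (show 0 < r ^ 2 by positivity)]
    gcongr
    exact (abs_lt.2 hx).le
  have h3 : ‖h x‖ ≤ ‖h 0‖ + ((2 * r)⁻¹ * N + r / 2 * (1 / r ^ 2)) := by
    calc ‖h x‖ = ‖h 0 + (h x - h 0)‖ := by congr 1; ring
      _ ≤ ‖h 0‖ + ‖h x - h 0‖ := norm_add_le _ _
      _ ≤ _ := by rw [h0]; gcongr
  calc ‖h x‖ * r ≤ (‖h 0‖ + ((2 * r)⁻¹ * N + r / 2 * (1 / r ^ 2))) * r := by gcongr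
    _ = ‖h 0‖ * r + N / 2 + 1 / 2 := by field_simp; ring
    _ ≤ ‖h 0‖ * 1 + N / 2 + 1 / 2 := by gcongr
    _ = _ := by ring

lemma v3_inv_sqrt : IntegrableOn (fun x : ℝ => 1 / √(1 - x ^ 2)) (Ioo (-1 : ℝ) 1) := by
  refine (intervalIntegral.integrableOn_deriv_of_nonneg (g := Real.arcsin)
    Real.continuous_arcsin.continuousOn (fun x hx => ?_) (fun x hx => by positivity)).mono_set
    Ioo_subset_Ioc_self
  exact Real.hasDerivAt_arcsin hx.1.ne' hx.2.ne

lemma v3_L1 {h : ℝ → ℂ} (hm : AEStronglyMeasurable h (volume.restrict (Ioo (-1 : ℝ) 1))) {M : ℝ}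
    (hM : ∀ x ∈ Ioo (-1 : ℝ) 1, ‖h x‖ * √(1 - x ^ 2) ≤ M) : IntegrableOn h (Ioo (-1 : ℝ) 1) := by
  refine Integrable.mono' (v3_inv_sqrt.const_mul M) hm ?_
  rw [ae_restrict_iff' measurableSet_Ioo]
  refine Eventually.of_forall fun x hx => ?_
  have hs : 0 < √(1 - x ^ 2) := Real.sqrt_pos.2 (by nlinarith [hx.1, hx.2])
  rw [mul_one_div, le_div_iff₀ hs]
  exact hM x hx

lemma v3_tendsto {f f' : ℝ → ℂ} (hi : IntegrableOn f' (Ioo (-1 : ℝ) 1))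
    (hf : ∀ x ∈ Ioo (-1 : ℝ) 1, ∀ y ∈ Ioo (-1 : ℝ) 1, f y - f x = ∫ t in x..y, f' t)
    (hw : IntegrableOn (fun x => ‖f x‖ ^ 2 * (1 - x ^ 2)⁻¹) (Ioo (-1 : ℝ) 1))
    {c : ℝ} (hc : c = 1 ∨ c = -1) : Tendsto f (𝓝[Ioo (-1 : ℝ) 1] c) (𝓝 0) := by
  have hc2 : c ^ 2 = 1 := by rcases hc with rfl | rfl <;> norm_num
  have hcI : c ∈ Icc (-1 : ℝ) 1 := by rcases hc with rfl | rfl <;> norm_num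
  set F : ℝ → ℂ := fun x => f 0 + ∫ t in (0:ℝ)..x, f' t with hF
  have hFf : ∀ x ∈ Ioo (-1 : ℝ) 1, f x = F x := fun x hx => by
    simp only [hF, ← hf 0 (by norm_num) x hx]; ring
  have hint : IntervalIntegrable f' volume (-1) 1 := by
    rw [intervalIntegrable_iff_integrableOn_Ioo_of_le (by norm_num)]; exact hi
  have hFc : ContinuousOn F (Icc (-1 : ℝ) 1) := by
    have := intervalIntegral.continuousOn_primitive_interval' hint
      (a := 0) (by rw [uIcc_of_le] <;> norm_num)
    rw [uIcc_of_le (by norm_num)] at this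
    exact continuousOn_const.add this
  have hlim : Tendsto f (𝓝[Ioo (-1 : ℝ) 1] c) (𝓝 (F c)) := by
    refine ((hFc c hcI).mono_left (nhdsWithin_mono _ Ioo_subset_Icc_self)).congr' ?_
    filter_upwards [self_mem_nhdsWithin] with x hx using (hFf x hx).symm
  by_cases h0 : F c = 0
  · rwa [h0] at hlim
  exfalso
  set m := ‖F c‖ / 2 with hm
  have hm0 : 0 < m := by have := norm_pos_iff.2 h0; positivity
  have hev : ∀ᶠ x in 𝓝[Ioo (-1 : ℝ) 1] c, m < ‖f x‖ :=
    hlim.norm.eventually (lt_mem_nhds (by rw [hm]; have := norm_pos_iff.2 h0; linarith))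
  rw [eventually_nhdsWithin_iff, Metric.eventually_nhds_iff] at hev
  obtain ⟨ε, hε, hev⟩ := hev
  set δ := min (ε / 2) 1 with hδ
  have hδ0 : 0 < δ := by positivity
  have hδ1 : δ ≤ 1 := min_le_right _ _
  have hδ2 : δ ≤ ε / 2 := min_le_left _ _
  set d := c * (1 - δ) with hd
  have hne : d ≠ c := by
    rcases hc with rfl | rfl <;> rw [hd] <;> intro h <;> linarith
  have hbad : ¬ IntervalIntegrable (fun x => (x - c)⁻¹) volume d c := by
    rw [intervalIntegrable_sub_inv_iff]; simp [hne]
  apply hbad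
  have hsub : uIoc d c ⊆ Icc (-1 : ℝ) 1 ∧ ∀ x ∈ uIoc d c, |x - c| ≤ δ := by
    have : ∀ x ∈ uIoc d c, x ∈ Icc (-1 : ℝ) 1 ∧ |x - c| ≤ δ := by
      intro x hx
      have hx := mem_uIcc.1 (uIoc_subset_uIcc hx)
      rw [abs_le, mem_Icc]
      rcases hc with rfl | rfl <;> rw [hd] at hx <;> rcases hx with h | h <;>
        refine ⟨⟨?_, ?_⟩, ?_, ?_⟩ <;> linarith [h.1, h.2]
    exact ⟨fun x hx => (this x hx).1, fun x hx => (this x hx).2⟩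
  rw [intervalIntegrable_iff]
  have hw' : IntegrableOn (fun x => ‖f x‖ ^ 2 * (1 - x ^ 2)⁻¹) (uIoc d c) := by
    rw [← integrableOn_Icc_iff_integrableOn_Ioo] at hw
    exact hw.mono_set hsub.1
  refine Integrable.mono' (hw'.const_mul (2 / m ^ 2)) (by fun_prop) ?_
  have hne1 : ∀ᵐ x : ℝ, x ≠ c ∧ x ≠ -c := by
    have h1 : ∀ᵐ x : ℝ, x ≠ c := by simp [ae_iff, measure_singleton]
    have h2 : ∀ᵐ x : ℝ, x ≠ -c := by simp [ae_iff, measure_singleton]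
    exact h1.and h2
  rw [ae_restrict_iff' measurableSet_uIoc]
  filter_upwards [hne1] with x hxc hx
  have hxI := hsub.1 hx
  have hxd := hsub.2 x hx
  have hs : 0 < 1 - x ^ 2 := by
    have h1 : (c - x) * (c + x) ≠ 0 :=
      mul_ne_zero (sub_ne_zero.2 hxc.1.symm) (fun h => hxc.2 (by linarith))
    have h2 : (c - x) * (c + x) = 1 - x ^ 2 := by rw [← hc2]; ring
    rw [h2] at h1
    have h3 : 0 ≤ 1 - x ^ 2 := by nlinarith [hxI.1, hxI.2]
    exact lt_of_le_of_ne h3 h1.symm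
  have hxo : x ∈ Ioo (-1 : ℝ) 1 := by
    constructor <;> nlinarith [hxI.1, hxI.2]
  have hfx : m < ‖f x‖ := hev (by rw [Real.dist_eq]; linarith) hxo
  have hpos : 0 < |x - c| := abs_pos.2 (sub_ne_zero.2 hxc.1)
  have hup : 1 - x ^ 2 ≤ 2 * |x - c| := by
    have h2 : 1 - x ^ 2 = |x - c| * |c + x| := by
      rw [← abs_mul, ← abs_of_pos hs, abs_eq_abs]; right; rw [← hc2]; ring
    have h3 : |c + x| ≤ 2 := by
      rw [abs_le]; constructor <;> linarith [hxI.1, hxI.2, hcI.1, hcI.2]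
    rw [h2]; nlinarith
  rw [norm_inv, Real.norm_eq_abs]
  have hm2 : m ^ 2 ≤ ‖f x‖ ^ 2 := by gcongr
  calc |x - c|⁻¹ ≤ 2 * (1 - x ^ 2)⁻¹ := by
        rw [inv_le_iff_one_le_mul₀ hpos, mul_assoc, mul_comm (1 - x ^ 2)⁻¹, ← mul_assoc,
          ← div_eq_mul_inv, one_le_div hs]; exact hup
    _ = 2 / m ^ 2 * (m ^ 2 * (1 - x ^ 2)⁻¹) := by field_simp
    _ ≤ _ := by gcongr

lemma v3_tendsto_sqrt {h : ℝ → ℂ} {M : ℝ} {c : ℝ} (hc : c = 1 ∨ c = -1)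
    (hM : ∀ x ∈ Ioo (-1 : ℝ) 1, ‖h x‖ ≤ M * √(1 - x ^ 2)) :
    Tendsto h (𝓝[Ioo (-1 : ℝ) 1] c) (𝓝 0) := by
  have hc2 : c ^ 2 = 1 := by rcases hc with rfl | rfl <;> norm_num
  have h1 : Tendsto (fun x : ℝ => M * √(1 - x ^ 2)) (𝓝 c) (𝓝 0) := by
    have : Continuous (fun x : ℝ => M * √(1 - x ^ 2)) := by fun_prop
    have := this.tendsto c
    simpa [hc2] using this
  refine squeeze_zero_norm' ?_ (h1.mono_left nhdsWithin_le_nhds)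
  filter_upwards [self_mem_nhdsWithin] with x hx using hM x hx

lemma v3_nhds1 : 𝓝[Ioo (-1 : ℝ) 1] (1 : ℝ) = 𝓝[<] 1 := nhdsWithin_Ioo_eq_nhdsLT (by norm_num)
lemma v3_nhds2 : 𝓝[Ioo (-1 : ℝ) 1] (-1 : ℝ) = 𝓝[>] (-1) := nhdsWithin_Ioo_eq_nhdsGT (by norm_num)

lemma v3_all {f f' f'' f''' : ℝ → ℂ} (hf : InV3 f f' f'' f''') :
    ∃ M K : ℝ, (0 ≤ M ∧ ∀ x ∈ Ioo (-1 : ℝ) 1, ‖f'' x‖ * √(1 - x ^ 2) ≤ M) ∧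
      (∀ x ∈ Ioo (-1 : ℝ) 1, ‖f' x‖ ≤ K) ∧
      IntegrableOn f' (Ioo (-1 : ℝ) 1) ∧ IntegrableOn f'' (Ioo (-1 : ℝ) 1) ∧
      IntegrableOn (fun x => ((1 - x ^ 2 : ℝ) : ℂ) * f''' x) (Ioo (-1 : ℝ) 1) := by
  obtain ⟨i1, i2, i3, d1, d2, d3, w3, w2, w1, w0⟩ := hf
  obtain ⟨M, hM0, hM⟩ := v3_sqrt_bound d3 w3
  have I2 := v3_L1 (v3_meas i2) hM
  obtain ⟨K, hK⟩ := v3_bdd I2 d2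
  refine ⟨M, K, ⟨hM0, hM⟩, hK, v3_L2 (v3_meas i1) w1, I2, v3_L2 ?_ ?_⟩
  · refine AEStronglyMeasurable.mul ?_ (v3_meas i3)
    exact Continuous.aestronglyMeasurable (by fun_prop)
  · refine w3.congr_fun (fun x hx => ?_) measurableSet_Ioo
    simp only [norm_mul, mul_pow, Complex.norm_real, Real.norm_eq_abs, sq_abs]

lemma v3_w_bound {h : ℝ → ℂ} {M : ℝ}
    (hM : ∀ x ∈ Ioo (-1 : ℝ) 1, ‖h x‖ * √(1 - x ^ 2) ≤ M) (x : ℝ) (hx : x ∈ Ioo (-1 : ℝ) 1) :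
    ‖((1 - x ^ 2 : ℝ) : ℂ) * h x‖ ≤ M * √(1 - x ^ 2) := by
  have hs : 0 ≤ 1 - x ^ 2 := by nlinarith [hx.1, hx.2]
  rw [norm_mul, Complex.norm_real, Real.norm_eq_abs, abs_of_nonneg hs]
  calc (1 - x ^ 2) * ‖h x‖ = ‖h x‖ * √(1 - x ^ 2) * √(1 - x ^ 2) := by
        rw [mul_assoc, Real.mul_self_sqrt hs, mul_comm]
    _ ≤ _ := by gcongr; exact hM x hx

lemma v3_boundary {f f' f'' f''' : ℝ → ℂ} (k : ℝ) (hf : InV3 f f' f'' f''') {c : ℝ}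
    (hc : c = 1 ∨ c = -1) :
    Tendsto f (𝓝[Ioo (-1 : ℝ) 1] c) (𝓝 0) ∧
    Tendsto (fun x => -((1 - x ^ 2 : ℝ) : ℂ) * f'' x + (k : ℂ) * f x)
      (𝓝[Ioo (-1 : ℝ) 1] c) (𝓝 0) := by
  obtain ⟨M, K, ⟨hM0, hM⟩, hK, I1, I2, I3⟩ := v3_all hf
  obtain ⟨i1, i2, i3, d1, d2, d3, w3, w2, w1, w0⟩ := hf
  have h1 := v3_tendsto I1 d1 w0 hc
  refine ⟨h1, ?_⟩
  have h2 := v3_tendsto_sqrt hc (v3_w_bound hM)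
  have h3 := h2.neg.add (h1.const_mul (k : ℂ))
  simp only [neg_zero, mul_zero, add_zero] at h3
  simpa only [neg_mul] using h3

lemma v3_star_prim {h h' : ℝ → ℂ} {x y : ℝ} (e : h y - h x = ∫ t in x..y, h' t) :
    star (h y) - star (h x) = ∫ t in x..y, star (h' t) := by
  rw [← star_sub, e]
  simp only [intervalIntegral, star_sub]
  congr 1 <;> exact (integral_conj (𝕜 := ℂ)).symm

lemma v3_star_int {h : ℝ → ℂ} {x y : ℝ} (e : IntervalIntegrable h volume x y) :
    IntervalIntegrable (fun t => star (h t)) volume x y :=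
  ⟨LinearIsometryEquiv.integrable_comp_iff Complex.conjLIE |>.2 e.1,
    LinearIsometryEquiv.integrable_comp_iff Complex.conjLIE |>.2 e.2⟩

lemma v3_identity {f f' f'' f''' g g' g'' g''' : ℝ → ℂ} (k : ℝ)
    (hf : InV3 f f' f'' f''') (hg : InV3 g g' g'' g''') :
    ∫ x in Ioo (-1 : ℝ) 1,
        (2 * (x : ℂ) * f'' x - ((1 - x ^ 2 : ℝ) : ℂ) * f''' x + (k : ℂ) * f' x) *
          star (g' x) =
      ∫ x in Ioo (-1 : ℝ) 1,
        (((1 - x ^ 2 : ℝ) : ℂ) * f'' x * star (g'' x) + (k : ℂ) * f' x * star (g' x)) := by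
  obtain ⟨M, -, ⟨hM0, hM⟩, -, I1, I2, I3⟩ := v3_all hf
  obtain ⟨M', K, ⟨hM0', hM'⟩, hK, -, J2, -⟩ := v3_all hg
  obtain ⟨i1, i2, i3, d1, d2, d3, w3, w2, w1, w0⟩ := hf
  obtain ⟨j1, j2, j3, e1, e2, e3, -, -, -, -⟩ := hg
  have ae_of : ∀ {p : ℝ → Prop}, (∀ x ∈ Ioo (-1 : ℝ) 1, p x) →
      ∀ᵐ x ∂(volume.restrict (Ioo (-1 : ℝ) 1)), p x := fun h =>
    (ae_restrict_iff' measurableSet_Ioo).2 (Eventually.of_forall h)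
  have mg' : AEStronglyMeasurable (fun x => star (g' x)) (volume.restrict (Ioo (-1 : ℝ) 1)) :=
    continuous_star.comp_aestronglyMeasurable (v3_meas j1)
  have bg' : ∀ᵐ x ∂(volume.restrict (Ioo (-1 : ℝ) 1)), ‖star (g' x)‖ ≤ K :=
    ae_of fun x hx => by rw [norm_star]; exact hK x hx
  have sJ2 : IntegrableOn (fun x => star (g'' x)) (Ioo (-1 : ℝ) 1) :=
    LinearIsometryEquiv.integrable_comp_iff Complex.conjLIE |>.2 J2
  have A0 : IntegrableOn (fun x : ℝ => 2 * (x : ℂ) * f'' x) (Ioo (-1 : ℝ) 1) := by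
    refine Integrable.bdd_mul (c := 2) I2 (Continuous.aestronglyMeasurable (by fun_prop)) ?_
    refine ae_of fun x hx => ?_
    rw [norm_mul, Complex.norm_real, Real.norm_eq_abs]
    have := (abs_lt.2 hx).le
    norm_num
    linarith
  have A : IntegrableOn (fun x : ℝ => 2 * (x : ℂ) * f'' x * star (g' x)) (Ioo (-1 : ℝ) 1) :=
    Integrable.mul_bdd A0 mg' bg'
  have B : IntegrableOn (fun x : ℝ => ((1 - x ^ 2 : ℝ) : ℂ) * f''' x * star (g' x))
      (Ioo (-1 : ℝ) 1) := Integrable.mul_bdd I3 mg' bg'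
  have C : IntegrableOn (fun x : ℝ => ((1 - x ^ 2 : ℝ) : ℂ) * f'' x * star (g'' x))
      (Ioo (-1 : ℝ) 1) := by
    refine Integrable.bdd_mul (c := M) sJ2 ?_ ?_
    · exact AEStronglyMeasurable.mul (Continuous.aestronglyMeasurable (by fun_prop)) (v3_meas i2)
    · refine ae_of fun x hx => (v3_w_bound hM x hx).trans ?_
      have : √(1 - x ^ 2) ≤ 1 := by
        rw [Real.sqrt_le_left zero_le_one]; nlinarith [sq_nonneg x]
      nlinarith
  have D : IntegrableOn (fun x : ℝ => (k : ℂ) * f' x * star (g' x)) (Ioo (-1 : ℝ) 1) :=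
    Integrable.mul_bdd (I1.const_mul _) mg' bg'
  set F : ℝ → ℂ := fun x => f'' x * (((1 - x ^ 2 : ℝ) : ℂ) * star (g' x)) with hF
  set F' : ℝ → ℂ := fun x => f''' x * (((1 - x ^ 2 : ℝ) : ℂ) * star (g' x)) +
    f'' x * (-(2 * (x : ℂ)) * star (g' x) + ((1 - x ^ 2 : ℝ) : ℂ) * star (g'' x)) with hF'
  have hFF' : F' = fun x => ((1 - x ^ 2 : ℝ) : ℂ) * f''' x * star (g' x)
      - 2 * (x : ℂ) * f'' x * star (g' x) + ((1 - x ^ 2 : ℝ) : ℂ) * f'' x * star (g'' x) := by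
    funext x; simp only [hF']; ring
  have IF' : IntegrableOn F' (Ioo (-1 : ℝ) 1) := by
    rw [hFF']; exact (B.sub A).add C
  have ftc : ∀ a ∈ Ioo (-1 : ℝ) 1, ∀ b ∈ Ioo (-1 : ℝ) 1, F b - F a = ∫ t in a..b, F' t := by
    intro a ha b hb
    have hsub : uIcc a b ⊆ Ioo (-1 : ℝ) 1 := by
      rw [uIcc]; exact Icc_subset_Ioo (lt_min ha.1 hb.1) (max_lt ha.2 hb.2)
    have hp : ∀ y ∈ uIcc a b, IntervalIntegrable (fun x => -(2 * (x : ℂ)) * star (g' x) +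
        ((1 - x ^ 2 : ℝ) : ℂ) * star (g'' x)) volume a y ∧
        ((1 - y ^ 2 : ℝ) : ℂ) * star (g' y) - ((1 - a ^ 2 : ℝ) : ℂ) * star (g' a) =
        ∫ x in a..y, (-(2 * (x : ℂ)) * star (g' x) + ((1 - x ^ 2 : ℝ) : ℂ) * star (g'' x)) := by
      intro y hy
      have hsy : uIcc a y ⊆ Ioo (-1 : ℝ) 1 :=
        (uIcc_subset_uIcc left_mem_uIcc hy).trans hsub
      refine v3_parts (u := fun x => ((1 - x ^ 2 : ℝ) : ℂ)) (u' := fun x => -(2 * (x : ℂ)))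
        (v := fun x => star (g' x)) (v' := fun x => star (g'' x)) ?_
        (v3_star_int (j2 a ha y (hsub hy))) ?_ ?_
      · exact Continuous.intervalIntegrable (by fun_prop) _ _
      · intro z hz
        symm
        refine intervalIntegral.integral_eq_sub_of_hasDerivAt
          (f := fun x : ℝ => ((1 - x ^ 2 : ℝ) : ℂ)) ?_ ?_
        · intro t ht
          have h1 : HasDerivAt (fun x : ℝ => 1 - x ^ 2) (-(2 * t)) t := by
            simpa using (hasDerivAt_pow 2 t).const_sub 1
          have h2 := h1.ofReal_comp
          push_cast at h2 ⊢
          exact h2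
        · exact Continuous.intervalIntegrable (by fun_prop) _ _
      · intro z hz
        exact v3_star_prim (e2 a ha z (hsy hz))
    exact (v3_parts (u := f'') (v := fun x => ((1 - x ^ 2 : ℝ) : ℂ) * star (g' x))
      (i3 a ha b hb) (hp b right_mem_uIcc).1 (fun x hx => d3 a ha x (hsub hx))
      (fun x hx => (hp x hx).2)).2
  have hFb : ∀ x ∈ Ioo (-1 : ℝ) 1, ‖F x‖ ≤ (M * K) * √(1 - x ^ 2) := by
    intro x hx
    have h1 : F x = ((1 - x ^ 2 : ℝ) : ℂ) * f'' x * star (g' x) := by simp only [hF]; ring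
    rw [h1, norm_mul, norm_star]
    calc _ ≤ (M * √(1 - x ^ 2)) * K := by
          gcongr
          · exact v3_w_bound hM x hx
          · exact hK x hx
      _ = _ := by ring
  have hz : ∫ x in Ioo (-1 : ℝ) 1, F' x = 0 := by
    have ta : Tendsto (fun ε : ℝ => -1 + ε) (𝓝[>] 0) (𝓝 (-1)) := by
      have : Continuous (fun ε : ℝ => -1 + ε) := by fun_prop
      simpa using (this.tendsto 0).mono_left nhdsWithin_le_nhds
    have tb : Tendsto (fun ε : ℝ => 1 - ε) (𝓝[>] 0) (𝓝 1) := by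
      have : Continuous (fun ε : ℝ => 1 - ε) := by fun_prop
      simpa using (this.tendsto 0).mono_left nhdsWithin_le_nhds
    have hε : ∀ᶠ ε in 𝓝[>] (0 : ℝ), ε ∈ Ioo (0 : ℝ) 1 := Ioo_mem_nhdsGT one_pos
    have t1 := (aecover_Ioo_of_Ioc (μ := (volume : Measure ℝ)) ta
      tb).integral_tendsto_of_countably_generated IF'
    have ma : ∀ᶠ ε in 𝓝[>] (0 : ℝ), -1 + ε ∈ Ioo (-1 : ℝ) 1 := by
      filter_upwards [hε] with ε h
      constructor <;> linarith [h.1, h.2]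
    have mb : ∀ᶠ ε in 𝓝[>] (0 : ℝ), 1 - ε ∈ Ioo (-1 : ℝ) 1 := by
      filter_upwards [hε] with ε h
      constructor <;> linarith [h.1, h.2]
    have la := (v3_tendsto_sqrt (Or.inr rfl) hFb).comp (tendsto_nhdsWithin_iff.2 ⟨ta, ma⟩)
    have lb := (v3_tendsto_sqrt (Or.inl rfl) hFb).comp (tendsto_nhdsWithin_iff.2 ⟨tb, mb⟩)
    have t2 := lb.sub la
    rw [sub_zero] at t2
    have hhalf : ∀ᶠ ε in 𝓝[>] (0 : ℝ), ε ∈ Ioo (0 : ℝ) (1 / 2) := Ioo_mem_nhdsGT (by norm_num)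
    refine tendsto_nhds_unique t1 (t2.congr' ?_)
    filter_upwards [ma, mb, hhalf] with ε h1 h2 h3
    simp only [Function.comp]
    have hle : -1 + ε ≤ 1 - ε := by linarith [h3.2]
    have hss : Ioc (-1 + ε) (1 - ε) ⊆ Ioo (-1 : ℝ) 1 := fun x hx =>
      ⟨by linarith [h1.1, hx.1], by linarith [h2.2, hx.2]⟩
    rw [ftc _ h1 _ h2, intervalIntegral.integral_of_le hle,
      Measure.restrict_restrict measurableSet_Ioc,
      inter_eq_left.2 hss]
  rw [← sub_eq_zero, ← integral_sub]
  · have : ∫ x in Ioo (-1 : ℝ) 1, -F' x = 0 := by rw [integral_neg, hz, neg_zero]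
    rw [← this]
    congr 1
    funext x
    simp only [hF']; ring
  · refine ((A.sub B).add D).congr (Eventually.of_forall fun x => ?_)
    simp only [Pi.add_apply, Pi.sub_apply]; ring
  · exact C.add D

/-- Symmetry of the operator `T₁ f := ℓ[f] = -(1-x²)f'' + k f` with domain `V₃` in the
Hilbert space `(W₁, φ)`: for `f, g ∈ V₃`, the boundary values of `f`, `g`, `ℓ[f]`,
`ℓ[g]` all vanish (so all boundary terms in `φ` vanish), and
`φ(ℓ[f], g) = ∫ [(1-x²)f'' conj(g'') + k f' conj(g')] = φ(f, ℓ[g])`, where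
`(ℓ[f])' = 2x f'' - (1-x²) f''' + k f'`. -/
theorem T1_symmetric (k : ℝ) (hk : 0 < k)
    (f f' f'' f''' g g' g'' g''' : ℝ → ℂ)
    (hf : InV3 f f' f'' f''') (hg : InV3 g g' g'' g''') :
    -- boundary values of f and g vanish
    (Tendsto f (𝓝[<] (1 : ℝ)) (𝓝 0) ∧ Tendsto f (𝓝[>] (-1 : ℝ)) (𝓝 0)) ∧
    (Tendsto g (𝓝[<] (1 : ℝ)) (𝓝 0) ∧ Tendsto g (𝓝[>] (-1 : ℝ)) (𝓝 0)) ∧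
    -- boundary values of ℓ[f] and ℓ[g] vanish
    (Tendsto (fun x => -((1 - x ^ 2 : ℝ) : ℂ) * f'' x + (k : ℂ) * f x)
        (𝓝[<] (1 : ℝ)) (𝓝 0) ∧
      Tendsto (fun x => -((1 - x ^ 2 : ℝ) : ℂ) * f'' x + (k : ℂ) * f x)
        (𝓝[>] (-1 : ℝ)) (𝓝 0)) ∧
    (Tendsto (fun x => -((1 - x ^ 2 : ℝ) : ℂ) * g'' x + (k : ℂ) * g x)
        (𝓝[<] (1 : ℝ)) (𝓝 0) ∧
      Tendsto (fun x => -((1 - x ^ 2 : ℝ) : ℂ) * g'' x + (k : ℂ) * g x)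
        (𝓝[>] (-1 : ℝ)) (𝓝 0)) ∧
    -- φ(ℓ[f], g) = ∫ [(1-x²) f'' conj(g'') + k f' conj(g')]
    (∫ x in Ioo (-1 : ℝ) 1,
        (2 * (x : ℂ) * f'' x - ((1 - x ^ 2 : ℝ) : ℂ) * f''' x + (k : ℂ) * f' x) *
          star (g' x) =
      ∫ x in Ioo (-1 : ℝ) 1,
        (((1 - x ^ 2 : ℝ) : ℂ) * f'' x * star (g'' x) + (k : ℂ) * f' x * star (g' x))) ∧
    -- φ(f, ℓ[g]) = ∫ [(1-x²) f'' conj(g'') + k f' conj(g')]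
    (∫ x in Ioo (-1 : ℝ) 1,
        f' x *
          star (2 * (x : ℂ) * g'' x - ((1 - x ^ 2 : ℝ) : ℂ) * g''' x + (k : ℂ) * g' x) =
      ∫ x in Ioo (-1 : ℝ) 1,
        (((1 - x ^ 2 : ℝ) : ℂ) * f'' x * star (g'' x) + (k : ℂ) * f' x * star (g' x))) := by
  have b1 := v3_boundary k hf (Or.inl rfl)
  have b2 := v3_boundary k hf (Or.inr rfl)
  have c1 := v3_boundary k hg (Or.inl rfl)
  have c2 := v3_boundary k hg (Or.inr rfl)
  rw [v3_nhds1] at b1 c1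
  rw [v3_nhds2] at b2 c2
  refine ⟨⟨b1.1, b2.1⟩, ⟨c1.1, c2.1⟩, ⟨b1.2, b2.2⟩, ⟨c1.2, c2.2⟩, v3_identity k hf hg, ?_⟩
  have h := congrArg (starRingEnd ℂ) (v3_identity k hg hf)
  rw [← integral_conj, ← integral_conj] at h
  refine Eq.trans ?_ (h.trans ?_)
  · congr 1
    funext x
    simp only [← starRingEnd_apply, map_mul, Complex.conj_conj]
    ring
  · congr 1
    funext x
    simp only [← starRingEnd_apply, map_mul, map_add, Complex.conj_conj, Complex.conj_ofReal]
    ring
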